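/- For every s, t < 1 with s + t > 0, and f ∈ Ḣ^s(ℝ²), g ∈ Ḣ^t(ℝ²), one has ‖fg‖_{Ḣ^{s+t−1}} ≤ C(s,t) ‖f‖_{Ḣ^s} ‖g‖_{Ḣ^t}. -/

import Mathlib

open MeasureTheory FourierTransform

/-- The homogeneous Sobolev norm ‖f‖_{Ḣ^σ} = (∫ |ζ|^{2σ} |f̂(ζ)|² dζ)^{1/2} on ℝ². -/
noncomputable def homSobNorm (σ : ℝ) (f : EuclideanSpace ℝ (Fin 2) → ℂ) : ℝ :=
  Real.sqrt (∫ ζ : EuclideanSpace ℝ (Fin 2), ‖ζ‖ ^ (2 * σ) * ‖𝓕 f ζ‖ ^ 2)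

namespace Stmt14
open scoped ENNReal
open Set

abbrev E2 := EuclideanSpace ℝ (Fin 2)

/-- The weight. -/
noncomputable def w (α : ℝ) (x : E2) : ℝ≥0∞ := ENNReal.ofReal (‖x‖ ^ α)

@[fun_prop]
lemma measurable_w (α : ℝ) : Measurable (w α) := by
  unfold w; fun_prop

lemma w_mul {x : E2} (hx : x ≠ 0) (α β : ℝ) : w α x * w β x = w (α + β) x := by
  have : 0 < ‖x‖ := norm_pos_iff.mpr hx
  unfold w
  rw [← ENNReal.ofReal_mul (by positivity), Real.rpow_add this]

lemma w_zero (x : E2) : w 0 x = 1 := by simp [w]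

lemma w_sq (α : ℝ) (x : E2) : (w α x) ^ (2 : ℝ) = w (2 * α) x := by
  unfold w
  rw [ENNReal.ofReal_rpow_of_nonneg (by positivity) (by norm_num), ← Real.rpow_mul (norm_nonneg _),
    mul_comm]

/-- The weighted norm. -/
noncomputable def N (α : ℝ) (F : E2 → ℝ≥0∞) : ℝ≥0∞ :=
  (∫⁻ x, (w α x * F x) ^ (2 : ℝ)) ^ (1 / 2 : ℝ)

lemma cs {f g : E2 → ℝ≥0∞} (hf : Measurable f) (hg : Measurable g) :
    ∫⁻ x, f x * g x ≤ (∫⁻ x, f x ^ (2 : ℝ)) ^ (1 / 2 : ℝ) * (∫⁻ x, g x ^ (2 : ℝ)) ^ (1 / 2 : ℝ) :=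
  ENNReal.lintegral_mul_le_Lp_mul_Lq volume Real.HolderConjugate.two_two
    hf.aemeasurable hg.aemeasurable

lemma rpow_compare {a b : ℝ} (γ : ℝ) (ha : 0 < a) (hb : 0 < b) (h1 : a ≤ 2 * b) (h2 : b ≤ 2 * a) :
    a ^ γ ≤ 2 ^ |γ| * b ^ γ := by
  rcases le_total 0 γ with h | h
  · rw [abs_of_nonneg h, ← Real.mul_rpow (by norm_num) hb.le]
    exact Real.rpow_le_rpow ha.le h1 h
  · rw [abs_of_nonpos h, Real.rpow_neg (by norm_num), ← Real.inv_rpow (by norm_num),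
      ← Real.mul_rpow (by norm_num) hb.le]
    exact Real.rpow_le_rpow_of_nonpos (by positivity) (by linarith) h

lemma integrableOn_norm_rpow {α : ℝ} (hα : -1 < α) (R : ℝ) :
    IntegrableOn (fun x : E2 => ‖x‖ ^ (2 * α)) (Metric.ball 0 R) := by
  rw [integrableOn_fun_norm_addHaar (E := E2) volume (f := fun r => r ^ (2 * α))]
  rcases le_or_gt R 0 with hR | hR
  · rw [Ioo_eq_empty (by simpa using hR)]; simp
  have h := (intervalIntegral.intervalIntegrable_rpow' (a := 0) (b := R) (r := 1 + 2 * α)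
    (by linarith))
  rw [intervalIntegrable_iff_integrableOn_Ioo_of_le hR.le] at h
  refine h.congr_fun ?_ measurableSet_Ioo
  intro y hy
  simp [Real.rpow_add hy.1]

lemma ball_int {α : ℝ} (hα : α < 1) : ∃ c : ℝ≥0∞, c ≠ ⊤ ∧ ∀ y : E2, y ≠ 0 →
    (∫⁻ x, ({x : E2 | ‖x‖ ≤ ‖y‖}.indicator (w (-α)) x) ^ (2 : ℝ)) ^ (1 / 2 : ℝ)
      = c * w (1 - α) y := by
  refine ⟨(∫⁻ x, ({x : E2 | ‖x‖ ≤ 1}.indicator (w (-α)) x) ^ (2 : ℝ)) ^ (1 / 2 : ℝ), ?_, ?_⟩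
  · apply ENNReal.rpow_ne_top_of_nonneg (by norm_num)
    have h := (integrableOn_norm_rpow (α := -α) (by linarith) 2).2
    rw [hasFiniteIntegral_iff_ofReal (by filter_upwards with x; positivity)] at h
    refine ne_top_of_le_ne_top h.ne ?_
    rw [← lintegral_indicator measurableSet_ball]
    apply lintegral_mono
    intro x
    by_cases hx : ‖x‖ ≤ 1
    · have : x ∈ Metric.ball (0 : E2) 2 := by simp; linarith
      simp only [indicator_of_mem this, mem_ofPred_eq, hx, indicator_of_mem, w_sq]
      rfl
    · simp [hx]
  · intro y hy
    have hr : 0 < ‖y‖ := norm_pos_iff.mpr hy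
    set r := ‖y‖ with hrdef
    have hmeas : Measurable fun x : E2 => ({x : E2 | ‖x‖ ≤ r}.indicator (w (-α)) x) ^ (2 : ℝ) := by
      refine Measurable.pow_const (Measurable.indicator (by fun_prop) ?_) _
      exact measurableSet_le (by fun_prop) (by fun_prop)
    have h1 := lintegral_map (μ := (volume : Measure E2)) hmeas (measurable_const_smul r)
    rw [Measure.map_addHaar_smul _ hr.ne', lintegral_smul_measure] at h1
    have h2 : ∀ u : E2, ({x : E2 | ‖x‖ ≤ r}.indicator (w (-α)) (r • u)) ^ (2 : ℝ)
        = w (-(2 * α)) y * ({x : E2 | ‖x‖ ≤ 1}.indicator (w (-α)) u) ^ (2 : ℝ) := by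
      intro u
      have : ‖r • u‖ = r * ‖u‖ := by rw [norm_smul, Real.norm_of_nonneg hr.le]
      have h3 : (r • u ∈ {x : E2 | ‖x‖ ≤ r}) ↔ u ∈ {x : E2 | ‖x‖ ≤ 1} := by
        simp only [mem_ofPred_eq, this]
        constructor <;> intro h <;> nlinarith
      by_cases hu : u ∈ {x : E2 | ‖x‖ ≤ 1}
      · rw [indicator_of_mem hu, indicator_of_mem (h3.2 hu), w_sq, w_sq]
        unfold w
        rw [← ENNReal.ofReal_mul (by positivity), this, Real.mul_rpow hr.le (norm_nonneg _)]
        congr 3; ring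
      · rw [indicator_of_notMem hu, indicator_of_notMem (by rwa [h3])]
        simp
    simp_rw [h2] at h1
    rw [lintegral_const_mul' _ _ (by simp [w])] at h1
    have h4 : w 2 y * ENNReal.ofReal |(r ^ Module.finrank ℝ E2)⁻¹| = 1 := by
      unfold w
      rw [← ENNReal.ofReal_mul (by positivity), abs_of_nonneg (by positivity), ← hrdef]
      simp
      field_simp
    have h5 := congrArg (fun z => w 2 y * z) h1
    simp only [smul_eq_mul, ← mul_assoc, h4, one_mul, w_mul hy] at h5
    rw [h5, ENNReal.mul_rpow_of_nonneg _ _ (by norm_num), mul_comm]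
    congr 1
    rw [show (2 + -(2 * α)) = 2 * (1 - α) by ring, ← w_sq, ← ENNReal.rpow_mul]
    simp

lemma core {α β γ : ℝ} (hα : α < 1) (h : α + β + γ = 1) : ∃ M : ℝ≥0∞, M ≠ ⊤ ∧
    ∀ F G H : E2 → ℝ≥0∞, Measurable F → Measurable G → Measurable H →
    ∫⁻ y, ∫⁻ x, (if ‖x‖ ≤ ‖y‖ ∧ ‖x‖ ≤ ‖y - x‖ then F x * G y * H (y - x) else 0) ≤
      M * N α F * N β G * N γ H := by
  obtain ⟨c, hc, hcy⟩ := ball_int hα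
  set K : ℝ≥0∞ := ENNReal.ofReal (2 ^ |γ|) with hK
  refine ⟨K * c, ENNReal.mul_ne_top (by simp [K]) hc, ?_⟩
  intro F G H hF hG hH
  set a : E2 → ℝ≥0∞ := fun x => w α x * F x with ha
  set b : E2 → ℝ≥0∞ := fun x => w β x * G x with hb
  set d : E2 → ℝ≥0∞ := fun x => w γ x * H x with hd
  have ham : Measurable a := by fun_prop
  have hbm : Measurable b := by fun_prop
  have hdm : Measurable d := by fun_prop
  set Q : E2 → ℝ≥0∞ := fun y => (∫⁻ x, (a x * d (y - x)) ^ (2 : ℝ)) ^ (1 / 2 : ℝ) with hQ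
  have hQm : Measurable Q := by
    apply Measurable.pow_const
    apply Measurable.lintegral_prod_right (f := fun y x => (a x * d (y - x)) ^ (2 : ℝ))
    simp only [Function.uncurry_def]
    fun_prop
  have hne : ∀ᵐ x : E2, x ≠ 0 := by
    simp [ae_iff]
  have step : ∀ᵐ y : E2, ∫⁻ x, (if ‖x‖ ≤ ‖y‖ ∧ ‖x‖ ≤ ‖y - x‖ then F x * G y * H (y - x) else 0) ≤
      K * c * (b y * Q y) := by
    filter_upwards [hne] with y hy
    set P : E2 → ℝ≥0∞ := {x : E2 | ‖x‖ ≤ ‖y‖}.indicator (w (-α)) with hP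
    have hPm : Measurable P :=
      Measurable.indicator (by fun_prop) (measurableSet_le (by fun_prop) (by fun_prop))
    calc _ ≤ ∫⁻ x, K * w (-β - γ) y * b y * (P x * (a x * d (y - x))) := by
            apply lintegral_mono_ae
            filter_upwards [hne] with x hx
            split_ifs with hxy
            · obtain ⟨h1, h2⟩ := hxy
              have hy0 : 0 < ‖y‖ := norm_pos_iff.mpr hy
              have h3 : ‖y‖ ≤ 2 * ‖y - x‖ := by
                have := norm_add_le (y - x) x
                simp at this; linarith
              have h4 : ‖y - x‖ ≤ 2 * ‖y‖ := by
                have := norm_sub_le y x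
                linarith
              have h5 : w γ y ≤ K * w γ (y - x) := by
                rw [hK]; unfold w
                rw [← ENNReal.ofReal_mul (by positivity)]
                exact ENNReal.ofReal_le_ofReal (rpow_compare γ hy0 (by linarith) h3 h4)
              have h6 : w (-α) x * w α x = 1 := by rw [w_mul hx]; simp [w_zero]
              have h7 : w (-β - γ) y * w β y * w γ y = 1 := by
                rw [w_mul hy, w_mul hy]; ring_nf; simp [w_zero]
              rw [hP, indicator_of_mem (by exact h1)]
              calc F x * G y * H (y - x)
                  = (w (-α) x * w α x) * (w (-β - γ) y * w β y * w γ y) *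
                      (F x * G y * H (y - x)) := by rw [h6, h7]; simp
                _ ≤ (w (-α) x * w α x) * (w (-β - γ) y * w β y * (K * w γ (y - x))) *
                      (F x * G y * H (y - x)) := by gcongr
                _ = _ := by simp only [ha, hb, hd]; ring
            · exact zero_le
      _ = K * w (-β - γ) y * b y * ∫⁻ x, (P x * (a x * d (y - x))) := by
            rw [lintegral_const_mul]; fun_prop
      _ ≤ K * w (-β - γ) y * b y * ((∫⁻ x, P x ^ (2 : ℝ)) ^ (1 / 2 : ℝ) * Q y) := by
            gcongr
            exact cs hPm (by fun_prop)
      _ = K * c * (b y * Q y) * (w (-β - γ) y * w (1 - α) y) := by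
            rw [hcy y hy]; ring
      _ = _ := by
            rw [w_mul hy, show -β - γ + (1 - α) = 0 by linarith, w_zero, mul_one]
  calc _ ≤ ∫⁻ y, K * c * (b y * Q y) := lintegral_mono_ae step
    _ = K * c * ∫⁻ y, (b y * Q y) := by rw [lintegral_const_mul]; fun_prop
    _ ≤ K * c * (N β G * (∫⁻ y, Q y ^ (2 : ℝ)) ^ (1 / 2 : ℝ)) := by
        gcongr
        exact cs hbm hQm
    _ = K * c * (N β G * (N α F * N γ H)) := by
        congr 2
        simp only [hQ, ← ENNReal.rpow_mul]
        norm_num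
        rw [lintegral_lintegral_swap (by
          apply Measurable.aemeasurable
          simp only [Function.uncurry_def]
          fun_prop)]
        have : ∀ x, ∫⁻ y, (a x * d (y - x)) ^ 2 = a x ^ 2 * ∫⁻ y, d y ^ 2 := by
          intro x
          simp_rw [mul_pow]
          rw [lintegral_const_mul _ (by fun_prop), lintegral_sub_right_eq_self (fun y => d y ^ 2)]
        simp_rw [this]
        rw [lintegral_mul_const _ (by fun_prop), ENNReal.mul_rpow_of_nonneg _ _ (by norm_num)]
        simp [N, ha, hd]
    _ = _ := by ring

lemma N_neg (α : ℝ) (F : E2 → ℝ≥0∞) : N α (fun x => F (-x)) = N α F := by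
  unfold N
  rw [← lintegral_neg_eq_self (fun x => (w α x * F x) ^ (2 : ℝ))]
  simp [w]

lemma third_case {a b c : ℝ} (c1 : ¬ (b ≤ a ∧ b ≤ c)) (c2 : ¬ (c ≤ a ∧ c ≤ b)) :
    a ≤ b ∧ a ≤ c := by
  grind

lemma tri {s t : ℝ} (hs : s < 1) (ht : t < 1) (hst : 0 < s + t) : ∃ M : ℝ≥0∞, M ≠ ⊤ ∧
    ∀ F G H : E2 → ℝ≥0∞, Measurable F → Measurable G → Measurable H →
    ∫⁻ z, ∫⁻ y, H z * (G y * F (z - y)) ≤ M * N s F * N t G * N (1 - s - t) H := by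
  obtain ⟨M1, hM1, h1⟩ := core (α := t) (β := 1 - s - t) (γ := s) ht (by ring)
  obtain ⟨M2, hM2, h2⟩ := core (α := s) (β := 1 - s - t) (γ := t) hs (by ring)
  obtain ⟨M3, hM3, h3⟩ := core (α := 1 - s - t) (β := t) (γ := s) (by linarith) (by ring)
  refine ⟨M1 + M2 + M3, by simp [*], ?_⟩
  intro F G H hF hG hH
  set A1 : E2 → E2 → ℝ≥0∞ := fun z y =>
    if ‖y‖ ≤ ‖z‖ ∧ ‖y‖ ≤ ‖z - y‖ then G y * H z * F (z - y) else 0 with hA1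
  set A2 : E2 → E2 → ℝ≥0∞ := fun z y =>
    if ‖z - y‖ ≤ ‖z‖ ∧ ‖z - y‖ ≤ ‖y‖ then F (z - y) * H z * G y else 0 with hA2
  set A3 : E2 → E2 → ℝ≥0∞ := fun z y =>
    if ‖z‖ ≤ ‖y‖ ∧ ‖z‖ ≤ ‖y - z‖ then H z * G y * F (-(y - z)) else 0 with hA3
  have m1 : Measurable (Function.uncurry A1) := by
    refine Measurable.ite ?_ (by fun_prop) (by fun_prop)
    exact (measurableSet_le (f := fun p : E2 × E2 => ‖p.2‖) (g := fun p : E2 × E2 => ‖p.1‖)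
      (by fun_prop) (by fun_prop)).inter (measurableSet_le (f := fun p : E2 × E2 => ‖p.2‖)
      (g := fun p : E2 × E2 => ‖p.1 - p.2‖) (by fun_prop) (by fun_prop))
  have m2 : Measurable (Function.uncurry A2) := by
    refine Measurable.ite ?_ (by fun_prop) (by fun_prop)
    exact (measurableSet_le (f := fun p : E2 × E2 => ‖p.1 - p.2‖) (g := fun p : E2 × E2 => ‖p.1‖)
      (by fun_prop) (by fun_prop)).inter (measurableSet_le (f := fun p : E2 × E2 => ‖p.1 - p.2‖)
      (g := fun p : E2 × E2 => ‖p.2‖) (by fun_prop) (by fun_prop))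
  have m3 : Measurable (Function.uncurry A3) := by
    refine Measurable.ite ?_ (by fun_prop) (by fun_prop)
    exact (measurableSet_le (f := fun p : E2 × E2 => ‖p.1‖) (g := fun p : E2 × E2 => ‖p.2‖)
      (by fun_prop) (by fun_prop)).inter (measurableSet_le (f := fun p : E2 × E2 => ‖p.1‖)
      (g := fun p : E2 × E2 => ‖p.2 - p.1‖) (by fun_prop) (by fun_prop))
  have hpt : ∀ z y, H z * (G y * F (z - y)) ≤ A1 z y + A2 z y + A3 z y := by
    intro z y
    have hsym : ‖y - z‖ = ‖z - y‖ := norm_sub_rev _ _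
    by_cases c1 : ‖y‖ ≤ ‖z‖ ∧ ‖y‖ ≤ ‖z - y‖
    · have : H z * (G y * F (z - y)) = A1 z y := by simp only [hA1, if_pos c1]; ring
      rw [this, add_assoc]; exact le_self_add
    by_cases c2 : ‖z - y‖ ≤ ‖z‖ ∧ ‖z - y‖ ≤ ‖y‖
    · have : H z * (G y * F (z - y)) = A2 z y := by simp only [hA2, if_pos c2]; ring
      rw [this, add_comm (A1 z y), add_assoc]; exact le_self_add
    have c3 : ‖z‖ ≤ ‖y‖ ∧ ‖z‖ ≤ ‖y - z‖ := by
      rw [hsym]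
      exact third_case c1 c2
    have : H z * (G y * F (z - y)) = A3 z y := by simp only [hA3, if_pos c3, neg_sub]; ring
    rw [this]; exact le_add_self
  have i1 : ∫⁻ z, ∫⁻ y, A1 z y ≤ M1 * N s F * N t G * N (1 - s - t) H := by
    refine (h1 G H F hG hH hF).trans (le_of_eq ?_); ring
  have i2 : ∫⁻ z, ∫⁻ y, A2 z y ≤ M2 * N s F * N t G * N (1 - s - t) H := by
    refine (le_of_eq ?_).trans ((h2 F H G hF hH hG).trans (le_of_eq ?_))
    · congr 1; ext z
      rw [← lintegral_sub_left_eq_self _ z]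
      simp [hA2]
    · ring
  have i3 : ∫⁻ z, ∫⁻ y, A3 z y ≤ M3 * N s F * N t G * N (1 - s - t) H := by
    rw [lintegral_lintegral_swap m3.aemeasurable]
    refine (h3 H G (fun x => F (-x)) hH hG (by fun_prop)).trans (le_of_eq ?_)
    rw [N_neg]; ring
  calc _ ≤ ∫⁻ z, ∫⁻ y, (A1 z y + A2 z y + A3 z y) :=
        lintegral_mono fun z => lintegral_mono fun y => hpt z y
    _ = (∫⁻ z, ∫⁻ y, A1 z y) + (∫⁻ z, ∫⁻ y, A2 z y) + (∫⁻ z, ∫⁻ y, A3 z y) := by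
        have o1 : Measurable fun z => ∫⁻ y, A1 z y := m1.lintegral_prod_right'
        have o2 : Measurable fun z => ∫⁻ y, A2 z y := m2.lintegral_prod_right'
        have o12 : Measurable fun z => (∫⁻ y, A1 z y) + ∫⁻ y, A2 z y := o1.add o2
        rw [← lintegral_add_left o1, ← lintegral_add_left o12]
        congr 1; ext z
        have n1 : Measurable (A1 z) := m1.of_uncurry_left
        have n2 : Measurable (A2 z) := m2.of_uncurry_left
        have n12 : Measurable fun y => A1 z y + A2 z y := n1.add n2
        rw [lintegral_add_left n12, lintegral_add_left n1]
    _ ≤ _ := by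
        grw [i1, i2, i3]
        apply le_of_eq; ring

lemma schwartz_int {σ : ℝ} (hσ : -1 < σ) (h : SchwartzMap E2 ℂ) :
    Integrable (fun x : E2 => ‖x‖ ^ (2 * σ) * ‖h x‖ ^ 2) := by
  obtain ⟨k, hk⟩ := exists_nat_ge (2 * σ)
  set M := SchwartzMap.seminorm ℝ 0 0 h
  have hM : ∀ x, ‖h x‖ ≤ M := fun x => SchwartzMap.norm_le_seminorm ℝ h x
  have hM0 : 0 ≤ M := (norm_nonneg _).trans (hM 0)
  have j1 := ((integrableOn_norm_rpow hσ 1).integrable_indicator measurableSet_ball).const_mul (M ^ 2)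
  have j2 := (h.integrable_pow_mul volume k).const_mul M
  refine (j1.add j2).mono' ?_ ?_
  · apply Measurable.aestronglyMeasurable
    have := h.continuous.measurable
    fun_prop
  · filter_upwards with x
    rw [Real.norm_of_nonneg (by positivity)]
    have h1 := hM x
    have h0 := norm_nonneg (h x)
    by_cases hx : x ∈ Metric.ball (0 : E2) 1
    · simp only [Pi.add_apply, indicator_of_mem hx]
      have : ‖x‖ ^ (2 * σ) * ‖h x‖ ^ 2 ≤ M ^ 2 * ‖x‖ ^ (2 * σ) := by
        rw [mul_comm]; gcongr
      have : 0 ≤ M * (‖x‖ ^ k * ‖h x‖) := by positivity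
      linarith
    · simp only [Pi.add_apply, indicator_of_notMem hx]
      have hx1 : 1 ≤ ‖x‖ := by simpa using hx
      have : ‖x‖ ^ (2 * σ) ≤ ‖x‖ ^ k := by
        rw [← Real.rpow_natCast]
        exact Real.rpow_le_rpow_of_exponent_le hx1 hk
      calc _ ≤ ‖x‖ ^ k * (M * ‖h x‖) := by rw [pow_two]; gcongr
        _ = _ := by ring

lemma N_schwartz {σ : ℝ} (hσ : -1 < σ) (f : SchwartzMap E2 ℂ) :
    N σ (fun x => ‖𝓕 f x‖ₑ) = ENNReal.ofReal (homSobNorm σ f) := by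
  unfold N homSobNorm
  have := schwartz_int hσ (𝓕 f)
  rw [Real.sqrt_eq_rpow, ← ENNReal.ofReal_rpow_of_nonneg (by positivity) (by norm_num),
    ← SchwartzMap.fourier_coe,
    ofReal_integral_eq_lintegral_ofReal this (by filter_upwards with x; positivity)]
  congr 2; ext x
  rw [ENNReal.mul_rpow_of_nonneg _ _ (by norm_num), w_sq, ENNReal.ofReal_mul (by positivity)]
  simp [w, ENNReal.ofReal_pow]

/-- The product as a Schwartz function. -/
noncomputable def prodS (f g : SchwartzMap E2 ℂ) : SchwartzMap E2 ℂ :=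
  SchwartzMap.pairing (ContinuousLinearMap.mul ℂ ℂ) f g

lemma prodS_coe (f g : SchwartzMap E2 ℂ) : (prodS f g : E2 → ℂ) = fun x => f x * g x := by
  ext x; simp [prodS]

lemma fourier_fourier (f : SchwartzMap E2 ℂ) (x : E2) : 𝓕 (𝓕 f) x = f (-x) := by
  have h : 𝓕⁻ (𝓕 f) = f := by simp
  rw [SchwartzMap.fourier_coe]
  conv_rhs => rw [← h, SchwartzMap.fourierInv_coe]
  rw [Real.fourierInv_eq_fourier_neg, neg_neg]

lemma fourier_prod (f g : SchwartzMap E2 ℂ) (z : E2) :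
    𝓕 (prodS f g) z = ∫ y, 𝓕 g y * 𝓕 f (z - y) := by
  have h := SchwartzMap.convolution_apply (ContinuousLinearMap.mul ℂ ℂ) (𝓕 g) (𝓕 f) z
  rw [convolution_def] at h
  simp only [ContinuousLinearMap.mul_apply'] at h
  rw [← h]
  have h2 : 𝓕 (SchwartzMap.convolution (ContinuousLinearMap.mul ℂ ℂ) (𝓕 g) (𝓕 f))
      = 𝓕 (𝓕 (prodS f g)) := by
    rw [SchwartzMap.fourier_convolution]
    ext x
    rw [fourier_fourier]
    simp [fourier_fourier, prodS, mul_comm]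
  have h3 := congrArg (fun u : SchwartzMap E2 ℂ => 𝓕⁻ u) h2
  simp at h3
  rw [h3]

end Stmt14

open Stmt14 in
/-- Product estimate in homogeneous Sobolev spaces on ℝ²: for s, t < 1 with s + t > 0,
‖fg‖_{Ḣ^{s+t−1}} ≤ C(s,t) ‖f‖_{Ḣ^s} ‖g‖_{Ḣ^t}. -/
theorem stmt_14 (s t : ℝ) (hs : s < 1) (ht : t < 1) (hst : 0 < s + t) :
    ∃ C > 0, ∀ f g : SchwartzMap (EuclideanSpace ℝ (Fin 2)) ℂ,
      homSobNorm (s + t - 1) (fun x => f x * g x) ≤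
        C * homSobNorm s (fun x => f x) * homSobNorm t (fun x => g x) := by
  obtain ⟨M, hM, htri⟩ := tri hs ht hst
  refine ⟨M.toReal + 1, by positivity, ?_⟩
  intro f g
  set σ := s + t - 1 with hσ
  rw [← prodS_coe]
  set h := prodS f g with hh
  set H : E2 → ENNReal := fun x => w (2 * σ) x * ‖𝓕 h x‖ₑ with hH
  have mf : Measurable fun x => ‖𝓕 f x‖ₑ := (𝓕 f).continuous.measurable.enorm
  have mg : Measurable fun x => ‖𝓕 g x‖ₑ := (𝓕 g).continuous.measurable.enorm
  have mh : Measurable fun x => ‖𝓕 h x‖ₑ := (𝓕 h).continuous.measurable.enorm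
  have hne : ∀ᵐ x : E2, x ≠ 0 := by
    simp [ae_iff]
  have key := htri _ _ H mf mg (by fun_prop)
  rw [N_schwartz (by linarith), N_schwartz (by linarith)] at key
  have e1 : N (1 - s - t) H = N σ (fun x => ‖𝓕 h x‖ₑ) := by
    unfold N
    congr 1
    apply lintegral_congr_ae
    filter_upwards [hne] with x hx
    simp only [hH]
    rw [← mul_assoc, w_mul hx]
    congr 3; rw [hσ]; ring
  rw [e1, N_schwartz (by linarith)] at key
  have e2 : (ENNReal.ofReal (homSobNorm σ h)) ^ (2 : ℝ) ≤
      ∫⁻ z, ∫⁻ y, H z * (‖𝓕 g y‖ₑ * ‖𝓕 f (z - y)‖ₑ) := by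
    rw [← N_schwartz (by linarith), N, ← ENNReal.rpow_mul]
    norm_num
    apply lintegral_mono
    intro z
    simp only
    rw [lintegral_const_mul _ (by
      have : Measurable fun y => ‖𝓕 f (z - y)‖ₑ := mf.comp (measurable_const.sub measurable_id)
      fun_prop)]
    have hw : w σ z ^ 2 = w (2 * σ) z := by
      rw [← w_sq]; norm_num
    have hc : ‖𝓕 h z‖ₑ ≤ ∫⁻ y, ‖𝓕 g y‖ₑ * ‖𝓕 f (z - y)‖ₑ := by
      rw [hh, fourier_prod]
      refine (enorm_integral_le_lintegral_enorm _).trans (le_of_eq ?_)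
      simp
    calc _ = H z * ‖𝓕 h z‖ₑ := by rw [mul_pow, hw, hH]; ring
      _ ≤ _ := by gcongr
  have e3 := e2.trans key
  have n0 : ∀ a u, 0 ≤ homSobNorm a u := fun a u => Real.sqrt_nonneg _
  set X := homSobNorm σ h
  have hX : 0 ≤ X := n0 _ _
  rw [← ENNReal.ofReal_toReal hM, ← ENNReal.ofReal_mul (by positivity),
    ← ENNReal.ofReal_mul (mul_nonneg (by positivity) (n0 _ _)),
    ← ENNReal.ofReal_mul (mul_nonneg (mul_nonneg (by positivity) (n0 _ _)) (n0 _ _)),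
    ENNReal.ofReal_rpow_of_nonneg hX (by norm_num),
    ENNReal.ofReal_le_ofReal_iff
      (mul_nonneg (mul_nonneg (mul_nonneg (by positivity) (n0 _ _)) (n0 _ _)) hX)] at e3
  have hfg := mul_nonneg (n0 s f) (n0 t g)
  change X ≤ (M.toReal + 1) * homSobNorm s f * homSobNorm t g
  rcases hX.eq_or_lt with h0 | h0
  · rw [← h0, mul_assoc]; positivity
  · have e4 : X * X ≤ (M.toReal * homSobNorm s f * homSobNorm t g) * X := by
      simpa [pow_two] using e3
    have := le_of_mul_le_mul_right e4 h0
    nlinarith
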